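/- For every positive integer i and every x > 0, y > 0 with y < 1 and x > 1, one has |ψ^(i)(1)| < |ψ^(i)(x)| + |ψ^(i)(y)| − |ψ^(i)(xy)| < |ψ^(i)(y)|. -/

import Mathlib

noncomputable def digamma : ℝ → ℝ := deriv (fun x => Real.log (Real.Gamma x))

noncomputable def polygamma (i : ℕ) : ℝ → ℝ := iteratedDeriv i digamma

open Set Filter Topology

/-- The Hurwitz zeta series `∑ (n + t)⁻ᵏ` at a natural number exponent `k`. -/
noncomputable def hurwitzSeries (k : ℕ) (t : ℝ) : ℝ := ∑' n : ℕ, (((n : ℝ) + t) ^ k)⁻¹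

theorem summable_inv_nat_add_pow {k : ℕ} (hk : 2 ≤ k) {t : ℝ} (ht : 0 < t) :
    Summable fun n : ℕ => (((n : ℝ) + t) ^ k)⁻¹ := by
  have h := (Real.summable_one_div_nat_add_rpow t k).2 (by exact_mod_cast hk)
  refine h.congr fun n => ?_
  have : (0 : ℝ) < n + t := by positivity
  rw [abs_of_pos this, Real.rpow_natCast, one_div]

theorem hurwitzSeries_pos {k : ℕ} (hk : 2 ≤ k) {t : ℝ} (ht : 0 < t) : 0 < hurwitzSeries k t :=
  (summable_inv_nat_add_pow hk ht).tsum_pos (fun n => by positivity) 0 (by positivity)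

theorem hurwitzSeries_strictAntiOn {k : ℕ} (hk : 2 ≤ k) :
    StrictAntiOn (hurwitzSeries k) (Ioi 0) := by
  intro s (hs : 0 < s) t (ht : 0 < t) hst
  have hlt : ∀ n : ℕ, (((n : ℝ) + t) ^ k)⁻¹ < (((n : ℝ) + s) ^ k)⁻¹ := fun n => by
    have : k ≠ 0 := by lia
    gcongr
  exact (summable_inv_nat_add_pow hk ht).tsum_lt_tsum (fun n => (hlt n).le) (hlt 0)
    (summable_inv_nat_add_pow hk hs)

theorem hasDerivAt_inv_add_pow (k : ℕ) (a : ℝ) {t : ℝ} (h : 0 < a + t) :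
    HasDerivAt (fun s : ℝ => ((a + s) ^ k)⁻¹) (-k * ((a + t) ^ (k + 1))⁻¹) t := by
  have h1 : HasDerivAt (fun s : ℝ => (a + s) ^ k) (k * (a + t) ^ (k - 1) * 1) t :=
    ((hasDerivAt_id t).const_add a).pow k
  refine (h1.fun_inv (pow_ne_zero k h.ne')).congr_deriv ?_
  rcases k with _ | k
  · simp
  · simp only [Nat.add_sub_cancel]
    field_simp
    ring

/-- Termwise differentiation of a series whose derivative is a multiple of the Hurwitz series. -/
theorem hasDerivAt_tsum_of_inv_nat_add_pow {g : ℕ → ℝ → ℝ} {k : ℕ} (hk : 2 ≤ k) (c : ℝ)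
    (hg : ∀ n : ℕ, ∀ s, 0 < s → HasDerivAt (g n) (c * (((n : ℝ) + s) ^ k)⁻¹) s)
    {t : ℝ} (ht : 0 < t) (hs : Summable fun n => g n t) :
    HasDerivAt (fun s => ∑' n, g n s) (c * hurwitzSeries k t) t := by
  have ht2 : 0 < t / 2 := by positivity
  have hmem : t ∈ Ioi (t / 2) := by simpa using ht
  have h := hasDerivAt_tsum_of_isPreconnected
    ((summable_inv_nat_add_pow hk ht2).mul_left |c|) isOpen_Ioi isPreconnected_Ioi
    (fun n s (hs : t / 2 < s) => hg n s (ht2.trans hs)) (fun n s (hs : t / 2 < s) => ?_) hmem hs hmem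
  · rwa [tsum_mul_left] at h
  · have : 0 < s := ht2.trans hs
    rw [norm_mul, Real.norm_eq_abs, Real.norm_of_nonneg (by positivity)]
    gcongr

theorem hasDerivAt_hurwitzSeries {k : ℕ} (hk : 2 ≤ k) {t : ℝ} (ht : 0 < t) :
    HasDerivAt (hurwitzSeries k) (-k * hurwitzSeries (k + 1) t) t :=
  hasDerivAt_tsum_of_inv_nat_add_pow (by lia) _
    (fun n s hs => hasDerivAt_inv_add_pow k n (by positivity)) ht (summable_inv_nat_add_pow hk ht)

theorem mul_inv_pow_succ_le_sub {a : ℝ} (ha : 0 < a) (k : ℕ) :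
    k * ((a + 1) ^ (k + 1))⁻¹ ≤ (a ^ k)⁻¹ - ((a + 1) ^ k)⁻¹ := by
  have h : 1 + k * (1 / a) ≤ (1 + 1 / a) ^ k :=
    one_add_mul_le_pow (by linarith [one_div_pos.2 ha]) k
  have e : (1 + 1 / a) ^ k = (a + 1) ^ k / a ^ k := by rw [← div_pow]; congr 1; field_simp
  have h2 : (k : ℝ) / (a + 1) ≤ k * (1 / a) := by
    rw [div_eq_mul_one_div]
    gcongr
    linarith
  have h3 : (k : ℝ) / (a + 1) ≤ (a + 1) ^ k / a ^ k - 1 := by linarith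
  calc k * ((a + 1) ^ (k + 1))⁻¹ = (k / (a + 1)) * ((a + 1) ^ k)⁻¹ := by
        field_simp
        ring
    _ ≤ ((a + 1) ^ k / a ^ k - 1) * ((a + 1) ^ k)⁻¹ := by gcongr
    _ = _ := by field_simp

theorem sum_range_succ_nat_mul_inv_pow_le {t : ℝ} (ht : 0 < t) (k N : ℕ) :
    ∑ n ∈ Finset.range (N + 1),
      (k * n * (((n : ℝ) + t) ^ (k + 1))⁻¹ - (((n : ℝ) + t) ^ k)⁻¹) ≤
      -((N + 1) * (((N : ℝ) + t) ^ k)⁻¹) := by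
  induction N with
  | zero => simp
  | succ N ih =>
    rw [Finset.sum_range_succ]
    have h := mul_inv_pow_succ_le_sub (a := N + t) (by positivity) k
    have h' := mul_le_mul_of_nonneg_left h (by positivity : (0 : ℝ) ≤ N + 1)
    have e : ((N + 1 : ℕ) : ℝ) + t = N + t + 1 := by push_cast; ring
    rw [e]
    push_cast
    linarith

theorem sub_one_mul_hurwitzSeries_le {k : ℕ} (hk : 2 ≤ k) {t : ℝ} (ht : 0 < t) :
    (k - 1) * hurwitzSeries k t ≤ k * t * hurwitzSeries (k + 1) t := by
  have s1 := ((summable_inv_nat_add_pow hk ht).hasSum).mul_left ((k : ℝ) - 1)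
  have s2 := ((summable_inv_nat_add_pow (k := k + 1) (by lia) ht).hasSum).mul_left (k * t)
  refine sub_nonpos.1 (le_of_tendsto ((s1.sub s2).tendsto_sum_nat.comp (tendsto_add_atTop_nat 1))
    (Eventually.of_forall fun N => ?_))
  refine le_trans (le_of_eq (Finset.sum_congr rfl fun n _ => ?_))
    ((sum_range_succ_nat_mul_inv_pow_le ht k N).trans (neg_nonpos.2 (by positivity)))
  have : (0 : ℝ) < n + t := by positivity
  field_simp
  ring

theorem mul_hurwitzSeries_strictAntiOn {k : ℕ} (hk : 3 ≤ k) :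
    StrictAntiOn (fun t => t * hurwitzSeries k t) (Ioi 0) := by
  have hd : ∀ t ∈ Ioi (0 : ℝ), HasDerivAt (fun t => t * hurwitzSeries k t)
      (1 * hurwitzSeries k t + t * (-k * hurwitzSeries (k + 1) t)) t := fun t ht =>
    (hasDerivAt_id t).mul (hasDerivAt_hurwitzSeries (by lia) ht)
  refine strictAntiOn_of_deriv_neg (convex_Ioi 0)
    (fun t ht => (hd t ht).continuousAt.continuousWithinAt) fun t ht => ?_
  rw [interior_Ioi] at ht
  rw [(hd t ht).deriv]
  have h1 := sub_one_mul_hurwitzSeries_le (by lia : 2 ≤ k) ht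
  have h2 := hurwitzSeries_pos (by lia : 2 ≤ k) ht
  have h3 : (3 : ℝ) ≤ k := by exact_mod_cast hk
  nlinarith

theorem hurwitzSeries_one_add_lt {k : ℕ} (hk : 2 ≤ k) {x y : ℝ} (hy0 : 0 < y) (hy : y < 1)
    (hx : 1 < x) :
    hurwitzSeries k 1 + hurwitzSeries k (x * y) < hurwitzSeries k x + hurwitzSeries k y := by
  have hd : ∀ t ∈ Ioi (0 : ℝ), HasDerivAt (fun t => hurwitzSeries k t - hurwitzSeries k (t * y))
      (-k * hurwitzSeries (k + 1) t - -k * hurwitzSeries (k + 1) (t * y) * (1 * y)) t :=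
    fun t ht => (hasDerivAt_hurwitzSeries hk ht).sub
      (HasDerivAt.comp (h := fun s => s * y) t (hasDerivAt_hurwitzSeries hk (mul_pos ht hy0))
        ((hasDerivAt_id t).mul_const y))
  have hmono : StrictMonoOn (fun t => hurwitzSeries k t - hurwitzSeries k (t * y)) (Ioi 0) := by
    refine strictMonoOn_of_deriv_pos (convex_Ioi 0)
      (fun t ht => (hd t ht).continuousAt.continuousWithinAt) fun t ht => ?_
    rw [interior_Ioi] at ht
    rw [(hd t ht).deriv]
    have ht0 : 0 < t := ht
    have h : t * hurwitzSeries (k + 1) t < t * y * hurwitzSeries (k + 1) (t * y) :=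
      mul_hurwitzSeries_strictAntiOn (k := k + 1) (by lia) (mul_pos ht0 hy0) ht
        (mul_lt_of_lt_one_right ht0 hy)
    have h' : hurwitzSeries (k + 1) t < y * hurwitzSeries (k + 1) (t * y) := by
      rw [mul_assoc] at h
      exact lt_of_mul_lt_mul_left h ht0.le
    have hk0 : (0 : ℝ) < k := by exact_mod_cast (by lia : 0 < k)
    nlinarith
  have h := hmono (mem_Ioi.2 one_pos) (mem_Ioi.2 (one_pos.trans hx)) hx
  simp only [one_mul] at h
  linarith

theorem differentiableAt_log_Gamma {x : ℝ} (hx : 0 < x) :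
    DifferentiableAt ℝ (fun x => Real.log (Real.Gamma x)) x :=
  (Real.differentiableAt_Gamma fun m => by
    have : (0 : ℝ) ≤ m := m.cast_nonneg
    linarith).log (Real.Gamma_pos_of_pos hx).ne'

theorem digamma_monotoneOn : MonotoneOn digamma (Ioi 0) :=
  Real.convexOn_log_Gamma.monotoneOn_deriv fun _ hx => differentiableAt_log_Gamma hx

theorem digamma_add_one {x : ℝ} (hx : 0 < x) : digamma (x + 1) = digamma x + x⁻¹ := by
  have h : (fun s => Real.log (Real.Gamma (s + 1))) =ᶠ[𝓝 x]
      fun s => Real.log (Real.Gamma s) + Real.log s := by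
    filter_upwards [Ioi_mem_nhds hx] with s (hs : 0 < s)
    rw [Real.Gamma_add_one hs.ne', Real.log_mul hs.ne' (Real.Gamma_pos_of_pos hs).ne', add_comm]
  rw [digamma, ← deriv_comp_add_const (fun s => Real.log (Real.Gamma s)), h.deriv_eq]
  exact ((differentiableAt_log_Gamma hx).hasDerivAt.add (Real.hasDerivAt_log hx.ne')).deriv

theorem digamma_add_nat_le {x : ℝ} (hx : 0 < x) (m : ℕ) :
    digamma (x + m) ≤ digamma x + m * x⁻¹ := by
  induction m with
  | zero => simp
  | succ m ih =>
    have h : (x + m)⁻¹ ≤ x⁻¹ := by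
      gcongr
      linarith [m.cast_nonneg (α := ℝ)]
    push_cast
    rw [← add_assoc, digamma_add_one (by positivity)]
    linarith

theorem digamma_add_nat {x : ℝ} (hx : 0 < x) (n : ℕ) :
    digamma (x + n) = digamma x + ∑ j ∈ Finset.range n, ((j : ℝ) + x)⁻¹ := by
  induction n with
  | zero => simp
  | succ n ih =>
    push_cast
    rw [← add_assoc, digamma_add_one (by positivity), ih, Finset.sum_range_succ, add_comm x n]
    ring

theorem tendsto_digamma_add_nat_sub {x : ℝ} (hx : 0 < x) :
    Tendsto (fun n : ℕ => digamma (x + n) - digamma (1 + n)) atTop (𝓝 0) := by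
  obtain ⟨m, hm⟩ := exists_nat_ge x
  have hinv : ∀ a : ℝ, Tendsto (fun n : ℕ => (a + n)⁻¹) atTop (𝓝 0) := fun a =>
    tendsto_inv_atTop_zero.comp (tendsto_atTop_add_const_left _ a tendsto_natCast_atTop_atTop)
  have hlo := (hinv x).neg
  have hup := (hinv 1).const_mul (m : ℝ)
  rw [neg_zero] at hlo
  rw [mul_zero] at hup
  refine tendsto_of_tendsto_of_tendsto_of_le_of_le hlo hup (fun n => ?_) fun n => ?_
  · have h1 := digamma_add_one (x := x + n) (by positivity)
    have h2 := digamma_monotoneOn (a := 1 + n) (b := x + n + 1) (mem_Ioi.2 (by positivity))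
      (mem_Ioi.2 (by positivity)) (by linarith)
    simp only
    linarith
  · have h1 := digamma_add_nat_le (x := 1 + n) (by positivity) m
    have h2 := digamma_monotoneOn (a := x + n) (b := 1 + n + m) (mem_Ioi.2 (by positivity))
      (mem_Ioi.2 (by positivity)) (by linarith)
    simp only
    linarith

theorem summable_inv_nat_add_one_sub {x : ℝ} (hx : 0 < x) :
    Summable fun n : ℕ => ((n : ℝ) + 1)⁻¹ - ((n : ℝ) + x)⁻¹ := by
  have hm : 0 < min 1 x := lt_min one_pos hx
  refine Summable.of_norm_bounded ((summable_inv_nat_add_pow le_rfl hm).mul_left |x - 1|)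
    fun n => ?_
  have h1 : (0 : ℝ) < n + 1 := by positivity
  have h2 : (0 : ℝ) < n + x := by positivity
  have h3 : (0 : ℝ) < n + min 1 x := by positivity
  have e : ((n : ℝ) + 1)⁻¹ - ((n : ℝ) + x)⁻¹ = (x - 1) * (((n : ℝ) + 1) * (n + x))⁻¹ := by
    field_simp
    ring
  rw [e, norm_mul, Real.norm_eq_abs, Real.norm_of_nonneg (by positivity), sq]
  gcongr
  · exact min_le_left _ _
  · exact min_le_right _ _

theorem digamma_eq_tsum {x : ℝ} (hx : 0 < x) :
    digamma x = digamma 1 + ∑' n : ℕ, (((n : ℝ) + 1)⁻¹ - ((n : ℝ) + x)⁻¹) := by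
  have h := (summable_inv_nat_add_one_sub hx).hasSum.tendsto_sum_nat
  have h' := (tendsto_digamma_add_nat_sub hx).const_sub (digamma x - digamma 1)
  rw [sub_zero] at h'
  have := tendsto_nhds_unique (h.congr fun n => ?_) h'
  · linarith
  · rw [digamma_add_nat hx, digamma_add_nat one_pos, Finset.sum_sub_distrib]
    ring

theorem hasDerivAt_digamma {x : ℝ} (hx : 0 < x) : HasDerivAt digamma (hurwitzSeries 2 x) x := by
  have h := (hasDerivAt_tsum_of_inv_nat_add_pow (g := fun n s => ((n : ℝ) + 1)⁻¹ - ((n : ℝ) + s)⁻¹)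
    le_rfl 1 (fun n s hs => ?_) hx (summable_inv_nat_add_one_sub hx)).const_add (digamma 1)
  · rw [one_mul] at h
    refine h.congr_of_eventuallyEq ?_
    filter_upwards [Ioi_mem_nhds hx] with s hs using digamma_eq_tsum hs
  · simpa using (hasDerivAt_inv_add_pow 1 n (by positivity : 0 < n + s)).const_sub ((n : ℝ) + 1)⁻¹

theorem polygamma_succ_eq (i : ℕ) {x : ℝ} (hx : 0 < x) :
    polygamma (i + 1) x = (-1) ^ i * (i + 1).factorial * hurwitzSeries (i + 2) x := by
  induction i generalizing x with
  | zero => simpa [polygamma, iteratedDeriv_one] using (hasDerivAt_digamma hx).deriv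
  | succ i ih =>
    have h : polygamma (i + 1) =ᶠ[𝓝 x]
        fun s => (-1) ^ i * (i + 1).factorial * hurwitzSeries (i + 2) s := by
      filter_upwards [Ioi_mem_nhds hx] with s hs using ih hs
    rw [polygamma, iteratedDeriv_succ, ← polygamma, h.deriv_eq,
      ((hasDerivAt_hurwitzSeries (by lia) hx).const_mul _).deriv, Nat.factorial_succ (i + 1)]
    push_cast
    ring

theorem abs_polygamma_eq {i : ℕ} (hi : 0 < i) {x : ℝ} (hx : 0 < x) :
    |polygamma i x| = i.factorial * hurwitzSeries (i + 1) x := by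
  obtain ⟨i, rfl⟩ := Nat.exists_eq_add_one.2 hi
  have := hurwitzSeries_pos (by lia : 2 ≤ i + 2) hx
  rw [polygamma_succ_eq i hx, abs_mul, abs_mul, abs_pow, abs_neg, abs_one, one_pow, one_mul,
    Nat.abs_cast, abs_of_pos this]

theorem stmt15 (i : ℕ) (hi : 0 < i) (x y : ℝ) (hy0 : 0 < y) (hy : y < 1) (hx : 1 < x) :
    |polygamma i 1| < |polygamma i x| + |polygamma i y| - |polygamma i (x * y)| ∧
    |polygamma i x| + |polygamma i y| - |polygamma i (x * y)| < |polygamma i y| := by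
  have hx0 : 0 < x := one_pos.trans hx
  have hxy : 0 < x * y := mul_pos hx0 hy0
  have hf : (0 : ℝ) < i.factorial := by positivity
  have h1 := mul_lt_mul_of_pos_left
    (hurwitzSeries_one_add_lt (by lia : 2 ≤ i + 1) hy0 hy hx) hf
  have h2 := mul_lt_mul_of_pos_left (hurwitzSeries_strictAntiOn (by lia : 2 ≤ i + 1) hxy hx0
    (mul_lt_of_lt_one_right hx0 hy)) hf
  rw [abs_polygamma_eq hi one_pos, abs_polygamma_eq hi hx0, abs_polygamma_eq hi hy0,
    abs_polygamma_eq hi hxy]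
  constructor <;> linarith
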